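/- There is no prime q with q ≡ 2 (mod 3) and integer s satisfying q·(q + 1) = 3s². -/

import Mathlib

/-- There is no prime `q ≡ 2 (mod 3)` and integer `s` with `q(q + 1) = 3s²`. -/
theorem no_prime_two_mod_three_three_sq :
    ¬ ∃ (q : ℕ) (s : ℤ), q.Prime ∧ q % 3 = 2 ∧
      (q : ℤ) * ((q : ℤ) + 1) = 3 * s ^ 2 := by
  rintro ⟨q, s, hq, hmod, h⟩
  have hqZ : Prime (q : ℤ) := Nat.prime_iff_prime_int.mp hq
  have hs : (q : ℤ) ∣ s := by
    rcases hqZ.dvd_or_dvd (Dvd.intro _ h) with h3 | hs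
    · have h3 : q ∣ 3 := by exact_mod_cast h3
      rw [Nat.prime_dvd_prime_iff_eq hq Nat.prime_three] at h3
      omega
    · exact hqZ.dvd_of_dvd_pow hs
  obtain ⟨t, rfl⟩ := hs
  have hsucc : (q : ℤ) + 1 = q * (3 * t ^ 2) :=
    mul_left_cancel₀ hqZ.ne_zero (by linear_combination h)
  exact hqZ.not_dvd_one ⟨3 * t ^ 2 - 1, by linear_combination hsucc⟩
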